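/- Let 1 ≤ n ≤ N, θ_n ∈ [0,1/2], and α ∈ [0,1). Then for every 1 ≤ k ≤ n one has c_{n−k,n}^{(α)} ≥ (1/((1 + 3^r) τ_k)) ∫_{t_{k−1}}^{t_k} (t_n − s)^{−α}/Γ(1−α) ds. -/

import Mathlib

open Real MeasureTheory

/-- Graded mesh point `t_j = T (j/N)^r`. -/
noncomputable def gridT (T r : ℝ) (N j : ℕ) : ℝ := T * ((j : ℝ) / (N : ℝ)) ^ r

/-- Step size `τ_j = t_j - t_{j-1}`. -/
noncomputable def gridTau (T r : ℝ) (N j : ℕ) : ℝ := gridT T r N j - gridT T r N (j - 1)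

/-- Step-size ratio `ρ_j = τ_j / τ_{j+1}`. -/
noncomputable def gridRho (T r : ℝ) (N j : ℕ) : ℝ := gridTau T r N j / gridTau T r N (j + 1)

/-- Offset point `t_{n-θ} = θ t_{n-1} + (1-θ) t_n`. -/
noncomputable def tTheta (T r : ℝ) (N n : ℕ) (θ : ℝ) : ℝ :=
  θ * gridT T r N (n - 1) + (1 - θ) * gridT T r N n

/-- Coefficient `a_{n-k}^{(α)}`, parametrized by `k`. -/
noncomputable def coefA (T r : ℝ) (N n : ℕ) (θ α : ℝ) (k : ℕ) : ℝ :=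
  (1 / (gridTau T r N k * Real.Gamma (1 - α))) *
    ∫ s in (gridT T r N (k - 1))..(min (gridT T r N k) (tTheta T r N n θ)),
      (tTheta T r N n θ - s) ^ (-α)

/-- Coefficient `b_{n-k}^{(α)}`, parametrized by `k`. -/
noncomputable def coefB (T r : ℝ) (N n : ℕ) (θ α : ℝ) (k : ℕ) : ℝ :=
  (2 / (gridTau T r N k * (gridTau T r N k + gridTau T r N (k + 1)) * Real.Gamma (1 - α))) *
    ∫ s in (gridT T r N (k - 1))..(gridT T r N k),
      (s - (gridT T r N (k - 1) + gridT T r N k) / 2) * (tTheta T r N n θ - s) ^ (-α)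

/-- Coefficient `I_{n-k}^{(α)}`, parametrized by `k`. -/
noncomputable def coefI (T r : ℝ) (N n : ℕ) (θ α : ℝ) (k : ℕ) : ℝ :=
  (α / (Real.Gamma (1 - α) * gridTau T r N k)) *
    ∫ s in (gridT T r N (k - 1))..(gridT T r N k),
      (gridT T r N k - s) * (tTheta T r N n θ - s) ^ (-α - 1)

/-- Coefficient `J_{n-k}^{(α)}`, parametrized by `k`. -/
noncomputable def coefJ (T r : ℝ) (N n : ℕ) (θ α : ℝ) (k : ℕ) : ℝ :=
  (α / (Real.Gamma (1 - α) * gridTau T r N k)) *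
    ∫ s in (gridT T r N (k - 1))..(gridT T r N k),
      (s - gridT T r N (k - 1)) * (tTheta T r N n θ - s) ^ (-α - 1)

/-- Coefficient `c_{n-k,n}^{(α)}`, parametrized by `k` (`1 ≤ k ≤ n`). -/
noncomputable def coefC (T r : ℝ) (N n : ℕ) (θ α : ℝ) (k : ℕ) : ℝ :=
  if n = 1 then coefA T r N n θ α n
  else if k = n then coefA T r N n θ α n + gridRho T r N (n - 1) * coefB T r N n θ α (n - 1)
  else if k = 1 then coefA T r N n θ α 1 - coefB T r N n θ α 1
  else coefA T r N n θ α k + gridRho T r N (k - 1) * coefB T r N n θ α (k - 1)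
         - coefB T r N n θ α k

theorem gridT_strictMono {T r : ℝ} {N : ℕ} (hT : 0 < T) (hr : 1 ≤ r) (hN : 1 ≤ N) :
    StrictMono (gridT T r N) := by
  intro i j hij
  have hN' : (0 : ℝ) < N := by exact_mod_cast hN
  have hij' : (i : ℝ) < j := by exact_mod_cast hij
  unfold gridT
  gcongr

theorem gridTau_pos {T r : ℝ} {N k : ℕ} (hT : 0 < T) (hr : 1 ≤ r) (hN : 1 ≤ N) (hk : 1 ≤ k) :
    0 < gridTau T r N k :=
  sub_pos.2 (gridT_strictMono hT hr hN (by omega))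

theorem gridTau_le_succ {T r : ℝ} {N k : ℕ} (hT : 0 < T) (hr : 1 ≤ r) (hk : 1 ≤ k) :
    gridTau T r N k ≤ gridTau T r N (k + 1) := by
  obtain ⟨m, rfl⟩ : ∃ m, k = m + 1 := ⟨k - 1, by omega⟩
  have hx : (m : ℝ) / N ∈ Set.Ici (0 : ℝ) := Set.mem_Ici.2 (by positivity)
  have hy : ((m + 1 + 1 : ℕ) : ℝ) / N ∈ Set.Ici (0 : ℝ) := Set.mem_Ici.2 (by positivity)
  have hhalf : (0 : ℝ) ≤ 1 / 2 := by norm_num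
  have h := (convexOn_rpow hr).2 hx hy hhalf hhalf (add_halves 1)
  have hmid : (1 / 2 : ℝ) • ((m : ℝ) / N) + (1 / 2 : ℝ) • (((m + 1 + 1 : ℕ) : ℝ) / N)
      = ((m + 1 : ℕ) : ℝ) / N := by
    simp only [smul_eq_mul]
    push_cast
    ring
  rw [hmid] at h
  simp only [smul_eq_mul] at h
  have h' := mul_le_mul_of_nonneg_left h hT.le
  simp only [gridTau, gridT, Nat.add_sub_cancel]
  linarith

theorem gridT_pred_lt_tTheta {T r θ : ℝ} {N n : ℕ} (hT : 0 < T) (hr : 1 ≤ r) (hN : 1 ≤ N)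
    (hn : 1 ≤ n) (hθ : θ ≤ 1 / 2) : gridT T r N (n - 1) < tTheta T r N n θ := by
  have h := gridTau_pos hT hr hN hn
  unfold gridTau at h
  unfold tTheta
  nlinarith

theorem gridT_lt_tTheta {T r θ : ℝ} {N n k : ℕ} (hT : 0 < T) (hr : 1 ≤ r) (hN : 1 ≤ N)
    (hkn : k < n) (hθ : θ ≤ 1 / 2) : gridT T r N k < tTheta T r N n θ :=
  ((gridT_strictMono hT hr hN).monotone (by omega)).trans_lt
    (gridT_pred_lt_tTheta hT hr hN (by omega) hθ)

theorem tTheta_le_gridT {T r θ : ℝ} {N n : ℕ} (hT : 0 < T) (hr : 1 ≤ r) (hN : 1 ≤ N)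
    (hn : 1 ≤ n) (hθ : 0 ≤ θ) : tTheta T r N n θ ≤ gridT T r N n := by
  have h := gridTau_pos hT hr hN hn
  unfold gridTau at h
  unfold tTheta
  nlinarith

theorem continuousOn_sub_rpow {a b c : ℝ} (p : ℝ) (hbc : b < c) :
    ContinuousOn (fun s : ℝ => (c - s) ^ p) (Set.Icc a b) :=
  ContinuousOn.rpow_const (by fun_prop) fun s hs => Or.inl (by linarith [hs.2])

theorem integral_sub_rpow_neg {a b α : ℝ} (hα : α < 1) :
    ∫ s in a..b, (b - s) ^ (-α) = (b - a) ^ (1 - α) / (1 - α) := by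
  rw [intervalIntegral.integral_comp_sub_left (fun x => x ^ (-α)) b,
    integral_rpow (Or.inl (by linarith)), sub_self, neg_add_eq_sub,
    Real.zero_rpow (by linarith), sub_zero]

theorem integral_sub_mid_mul_nonneg {a b c α : ℝ} (hab : a ≤ b) (hbc : b < c) (hα : 0 ≤ α) :
    0 ≤ ∫ s in a..b, (s - (a + b) / 2) * (c - s) ^ (-α) := by
  have hcont := continuousOn_sub_rpow (a := a) (-α) hbc
  have hzero : ∫ s in a..b, (s - (a + b) / 2) * (c - (a + b) / 2) ^ (-α) = 0 := by
    rw [intervalIntegral.integral_mul_const, intervalIntegral.integral_sub (by simp) (by simp)]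
    simp only [integral_id, intervalIntegral.integral_const, smul_eq_mul]
    ring
  rw [← hzero]
  refine intervalIntegral.integral_mono_on hab (Continuous.intervalIntegrable (by fun_prop) _ _)
    (ContinuousOn.intervalIntegrable_of_Icc hab (ContinuousOn.mul (by fun_prop) hcont)) ?_
  intro s hs
  rcases le_total s ((a + b) / 2) with h | h
  · exact mul_le_mul_of_nonpos_left
      (Real.rpow_le_rpow_of_nonpos (by linarith) (by linarith) (by linarith)) (by linarith)
  · exact mul_le_mul_of_nonneg_left
      (Real.rpow_le_rpow_of_nonpos (by linarith [hs.2]) (by linarith) (by linarith)) (by linarith)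

theorem half_integral_le_integral_sub_weighted {a b c d σ α : ℝ} (hab : a < b) (hbc : b < c)
    (hcd : c ≤ d) (hσ : b - a ≤ σ) (hα : 0 ≤ α) :
    (1 / 2) * ∫ s in a..b, (d - s) ^ (-α) ≤
      (∫ s in a..b, (c - s) ^ (-α)) -
        2 / (b - a + σ) * ∫ s in a..b, (s - (a + b) / 2) * (c - s) ^ (-α) := by
  have hc := continuousOn_sub_rpow (a := a) (-α) hbc
  have hd := continuousOn_sub_rpow (a := a) (-α) (hbc.trans_le hcd)
  have hw : ContinuousOn (fun s : ℝ => (s - (a + b) / 2) * (c - s) ^ (-α)) (Set.Icc a b) :=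
    ContinuousOn.mul (by fun_prop) hc
  rw [← intervalIntegral.integral_const_mul, ← intervalIntegral.integral_const_mul,
    ← intervalIntegral.integral_sub (hc.intervalIntegrable_of_Icc hab.le)
      ((hw.intervalIntegrable_of_Icc hab.le).const_mul _)]
  refine intervalIntegral.integral_mono_on hab.le
    ((hd.intervalIntegrable_of_Icc hab.le).const_mul _)
    ((hc.intervalIntegrable_of_Icc hab.le).sub
      ((hw.intervalIntegrable_of_Icc hab.le).const_mul _)) ?_
  intro s hs
  have hpos : 0 < c - s := by linarith [hs.2]
  have hle : (d - s) ^ (-α) ≤ (c - s) ^ (-α) :=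
    Real.rpow_le_rpow_of_nonpos hpos (by linarith) (by linarith)
  have hnn : 0 ≤ (c - s) ^ (-α) := Real.rpow_nonneg hpos.le _
  have hweight : 2 / (b - a + σ) * (s - (a + b) / 2) ≤ 1 / 2 := by
    rw [div_mul_eq_mul_div, div_le_iff₀ (by linarith)]
    linarith [hs.2]
  have := mul_le_mul_of_nonneg_right hweight hnn
  rw [← mul_assoc]
  linarith

theorem coefB_nonneg {T r θ α : ℝ} {N n k : ℕ} (hT : 0 < T) (hr : 1 ≤ r) (hN : 1 ≤ N)
    (hk : 1 ≤ k) (hkn : k < n) (hθ : θ ≤ 1 / 2) (hα0 : 0 ≤ α) (hα1 : α < 1) :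
    0 ≤ coefB T r N n θ α k := by
  have h1 := gridTau_pos hT hr hN hk
  have h2 : 0 < gridTau T r N (k + 1) := gridTau_pos hT hr hN (by omega)
  have hΓ : 0 < Real.Gamma (1 - α) := Real.Gamma_pos_of_pos (by linarith)
  exact mul_nonneg (by positivity) (integral_sub_mid_mul_nonneg
    ((gridT_strictMono hT hr hN).monotone (by omega)) (gridT_lt_tTheta hT hr hN hkn hθ) hα0)

theorem gridRho_nonneg {T r : ℝ} {N k : ℕ} (hT : 0 < T) (hr : 1 ≤ r) (hN : 1 ≤ N)
    (hk : 1 ≤ k) : 0 ≤ gridRho T r N k :=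
  div_nonneg (gridTau_pos hT hr hN hk).le (gridTau_pos hT hr hN (by omega)).le

theorem kernel_average_le_half {T r α : ℝ} {N n k : ℕ} (hT : 0 < T) (hr : 1 ≤ r) (hN : 1 ≤ N)
    (hk : 1 ≤ k) (hkn : k ≤ n) (hα1 : α < 1) :
    (1 / ((1 + (3 : ℝ) ^ r) * gridTau T r N k)) *
        ∫ s in (gridT T r N (k - 1))..(gridT T r N k),
          (gridT T r N n - s) ^ (-α) / Real.Gamma (1 - α) ≤
      1 / (gridTau T r N k * Real.Gamma (1 - α)) *
        ((1 / 2) * ∫ s in (gridT T r N (k - 1))..(gridT T r N k),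
          (gridT T r N n - s) ^ (-α)) := by
  have hτ := gridTau_pos hT hr hN hk
  have hΓ : 0 < Real.Gamma (1 - α) := Real.Gamma_pos_of_pos (by linarith)
  have hmono := (gridT_strictMono hT hr hN).monotone
  have hI : 0 ≤ ∫ s in (gridT T r N (k - 1))..(gridT T r N k), (gridT T r N n - s) ^ (-α) :=
    intervalIntegral.integral_nonneg (hmono (by omega)) fun s hs =>
      Real.rpow_nonneg (by linarith [hs.2, hmono hkn]) _
  have h3 : (1 : ℝ) ≤ 3 ^ r := Real.one_le_rpow (by norm_num) (by linarith)
  rw [intervalIntegral.integral_div]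
  calc _ = 1 / (1 + (3 : ℝ) ^ r) * (1 / (gridTau T r N k * Real.Gamma (1 - α)) *
        ∫ s in (gridT T r N (k - 1))..(gridT T r N k), (gridT T r N n - s) ^ (-α)) := by
        field_simp
    _ ≤ 1 / 2 * (1 / (gridTau T r N k * Real.Gamma (1 - α)) *
        ∫ s in (gridT T r N (k - 1))..(gridT T r N k), (gridT T r N n - s) ^ (-α)) := by
        gcongr
        linarith
    _ = _ := by ring

theorem kernel_average_le_coefA_last {T r θ α : ℝ} {N n : ℕ} (hT : 0 < T) (hr : 1 ≤ r)
    (hN : 1 ≤ N) (hn : 1 ≤ n) (hθ0 : 0 ≤ θ) (hθ : θ ≤ 1 / 2) (hα0 : 0 ≤ α) (hα1 : α < 1) :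
    (1 / ((1 + (3 : ℝ) ^ r) * gridTau T r N n)) *
        ∫ s in (gridT T r N (n - 1))..(gridT T r N n),
          (gridT T r N n - s) ^ (-α) / Real.Gamma (1 - α) ≤ coefA T r N n θ α n := by
  have hτ := gridTau_pos hT hr hN hn
  have hΓ : 0 < Real.Gamma (1 - α) := Real.Gamma_pos_of_pos (by linarith)
  refine (kernel_average_le_half hT hr hN hn le_rfl hα1).trans ?_
  unfold coefA
  rw [min_eq_right (tTheta_le_gridT hT hr hN hn hθ0), integral_sub_rpow_neg hα1,
    integral_sub_rpow_neg hα1]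
  have hlen : tTheta T r N n θ - gridT T r N (n - 1) = (1 - θ) * gridTau T r N n := by
    unfold tTheta gridTau
    ring
  rw [hlen, Real.mul_rpow (by linarith) hτ.le, mul_div_assoc]
  change _ * (1 / 2 * (gridTau T r N n ^ (1 - α) / (1 - α))) ≤ _
  have hhalf : (1 / 2 : ℝ) ≤ (1 - θ) ^ (1 - α) := by
    have := Real.rpow_le_rpow_of_exponent_ge (x := 1 - θ) (y := 1) (z := 1 - α)
      (by linarith) (by linarith) (by linarith)
    rw [Real.rpow_one] at this
    linarith
  have : 0 < 1 - α := by linarith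
  gcongr

theorem kernel_average_le_coefA_sub_coefB {T r θ α : ℝ} {N n k : ℕ} (hT : 0 < T) (hr : 1 ≤ r)
    (hN : 1 ≤ N) (hk : 1 ≤ k) (hkn : k < n) (hθ0 : 0 ≤ θ) (hθ : θ ≤ 1 / 2) (hα0 : 0 ≤ α)
    (hα1 : α < 1) :
    (1 / ((1 + (3 : ℝ) ^ r) * gridTau T r N k)) *
        ∫ s in (gridT T r N (k - 1))..(gridT T r N k),
          (gridT T r N n - s) ^ (-α) / Real.Gamma (1 - α) ≤
      coefA T r N n θ α k - coefB T r N n θ α k := by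
  have hτ := gridTau_pos hT hr hN hk
  have hτ' : 0 < gridTau T r N (k + 1) := gridTau_pos hT hr hN (by omega)
  have hΓ : 0 < Real.Gamma (1 - α) := Real.Gamma_pos_of_pos (by linarith)
  have hlt := gridT_lt_tTheta hT hr hN hkn hθ
  have hmain := half_integral_le_integral_sub_weighted
    (gridT_strictMono hT hr hN (by omega : k - 1 < k)) hlt
    (tTheta_le_gridT hT hr hN (by omega) hθ0) (gridTau_le_succ (N := N) hT hr hk) hα0
  refine (kernel_average_le_half hT hr hN hk hkn.le hα1).trans
    ((mul_le_mul_of_nonneg_left hmain (by positivity)).trans_eq ?_)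
  unfold coefA coefB
  rw [min_eq_left hlt.le, mul_sub, ← mul_assoc]
  congr 2
  change _ * (2 / (gridTau T r N k + _)) = _
  field_simp

/-- For `1 ≤ n ≤ N`, `θ ∈ [0,1/2]`, `α ∈ [0,1)` and `1 ≤ k ≤ n`:
`c_{n-k,n}^{(α)} ≥ (1/((1+3^r) τ_k)) ∫_{t_{k-1}}^{t_k} (t_n-s)^{-α}/Γ(1-α) ds`. -/
theorem coefC_lower (T r : ℝ) (N n : ℕ) (θ α : ℝ)
    (hT : 0 < T) (hr : 1 ≤ r) (hN : 1 ≤ N) (hn1 : 1 ≤ n) (hnN : n ≤ N)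
    (hθ0 : 0 ≤ θ) (hθ : θ ≤ 1 / 2) (hα0 : 0 ≤ α) (hα1 : α < 1) :
    ∀ k : ℕ, 1 ≤ k → k ≤ n →
      (1 / ((1 + (3 : ℝ) ^ r) * gridTau T r N k)) *
          ∫ s in (gridT T r N (k - 1))..(gridT T r N k),
            (gridT T r N n - s) ^ (-α) / Real.Gamma (1 - α)
        ≤ coefC T r N n θ α k := by
  intro k hk hkn
  unfold coefC
  rcases hkn.eq_or_lt with rfl | hlt
  · have hA := kernel_average_le_coefA_last hT hr hN hk hθ0 hθ hα0 hα1
    rw [if_pos rfl]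
    split_ifs with h1
    · exact hA
    · have hB : 0 ≤ coefB T r N k θ α (k - 1) :=
        coefB_nonneg hT hr hN (by omega) (by omega) hθ hα0 hα1
      have hρ : 0 ≤ gridRho T r N (k - 1) := gridRho_nonneg hT hr hN (by omega)
      linarith [mul_nonneg hρ hB]
  · have hAB := kernel_average_le_coefA_sub_coefB hT hr hN hk hlt hθ0 hθ hα0 hα1
    rw [if_neg (by omega), if_neg hlt.ne]
    split_ifs with h1
    · subst h1
      exact hAB
    · have hB : 0 ≤ coefB T r N n θ α (k - 1) :=
        coefB_nonneg hT hr hN (by omega) (by omega) hθ hα0 hα1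
      have hρ : 0 ≤ gridRho T r N (k - 1) := gridRho_nonneg hT hr hN (by omega)
      linarith [mul_nonneg hρ hB]
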